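/- Let L be a first-order language and T a complete L-theory. Then T is stable (no L-formula has the order property over T) if and only if for every formula φ(x₁,…,x_n; y₁,…,y_m) of L and every model M of T, the associated two-person win-lose game G(L,T,φ,M) — in which player 1 chooses an n-tuple a of elements of M, player 2 chooses an m-tuple b of elements of M, and player 1 wins if and only if M ⊨ φ(a; b) — is totally minimax. -/

import Mathlib

open scoped ENNReal Classical

open FirstOrder

universe u v w

/-- The expected payoff to player 1 (probability that player 1 wins) when player 1
uses mixed strategy `p` and player 2 uses mixed strategy `q`. -/
noncomputable def mixedPayoff {S T : Type*} (π : S → T → Prop) (p : PMF S) (q : PMF T) : ℝ≥0∞ :=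
  ∑' s, ∑' t, p s * q t * (if π s t then 1 else 0)

/-- The minimax property: `sup_p inf_q π^mix(p,q) = inf_q sup_p π^mix(p,q)`. -/
def Minimax {S T : Type*} (π : S → T → Prop) : Prop :=
  (⨆ p : PMF S, ⨅ q : PMF T, mixedPayoff π p q)
    = ⨅ q : PMF T, ⨆ p : PMF S, mixedPayoff π p q

/-- A game is totally minimax if every subgame of it satisfies the minimax property. -/
def TotallyMinimax {S T : Type*} (π : S → T → Prop) : Prop :=
  ∀ (S' : Set S) (T' : Set T), S'.Nonempty → T'.Nonempty →
    Minimax fun (s : S') (t : T') => π s t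

section Games

open Filter Topology MeasureTheory

/-- The finitely supported probability weights on `S`. -/
def finProb (S : Type*) : Set (S →₀ ℝ) :=
  {p | (∀ s, 0 ≤ p s) ∧ ∑ s ∈ p.support, p s = 1}

/-- The mean of `g` with respect to the finitely supported weights `p`. -/
noncomputable def wmean {S : Type*} (p : S →₀ ℝ) (g : S → ℝ) : ℝ :=
  ∑ s ∈ p.support, p s * g s

section Weights

variable {S T : Type*}

lemma wmean_eq_linearCombination (p : S →₀ ℝ) (g : S → ℝ) :
    wmean p g = Finsupp.linearCombination ℝ g p := rfl

lemma wmean_one (p : S →₀ ℝ) : wmean p (fun _ => 1) = ∑ s ∈ p.support, p s := by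
  simp [wmean]

lemma wmean_const {p : S →₀ ℝ} (hp : p ∈ finProb S) (c : ℝ) : wmean p (fun _ => c) = c := by
  rw [wmean, ← Finset.sum_mul, hp.2, one_mul]

lemma wmean_mono {p : S →₀ ℝ} (hp : p ∈ finProb S) {g h : S → ℝ}
    (hgh : ∀ s ∈ p.support, g s ≤ h s) : wmean p g ≤ wmean p h :=
  Finset.sum_le_sum fun s hs => mul_le_mul_of_nonneg_left (hgh s hs) (hp.1 s)

lemma wmean_neg (p : S →₀ ℝ) (g : S → ℝ) : wmean p (fun s => -g s) = -wmean p g := by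
  simp [wmean]

lemma wmean_add (p : S →₀ ℝ) (g h : S → ℝ) :
    wmean p (fun s => g s + h s) = wmean p g + wmean p h := by
  simp [wmean, mul_add, Finset.sum_add_distrib]

lemma wmean_const_mul (p : S →₀ ℝ) (c : ℝ) (g : S → ℝ) :
    wmean p (fun s => c * g s) = c * wmean p g := by
  simp only [wmean, Finset.mul_sum]
  exact Finset.sum_congr rfl fun _ _ => by ring

lemma wmean_finset_sum {ι : Type*} (p : S →₀ ℝ) (I : Finset ι) (g : ι → S → ℝ) :
    wmean p (fun s => ∑ i ∈ I, g i s) = ∑ i ∈ I, wmean p (g i) := by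
  simp only [wmean, Finset.mul_sum]
  exact Finset.sum_comm

lemma wmean_comm (p : S →₀ ℝ) (q : T →₀ ℝ) (f : S → T → ℝ) :
    wmean p (fun s => wmean q (f s)) = wmean q (fun t => wmean p (fun s => f s t)) := by
  simp only [wmean, Finset.mul_sum]
  rw [Finset.sum_comm]
  exact Finset.sum_congr rfl fun _ _ => Finset.sum_congr rfl fun _ _ => by ring

lemma convex_finProb : Convex ℝ (finProb S) := by
  intro p hp q hq a b ha hb hab
  refine ⟨fun s => ?_, ?_⟩
  · have := mul_nonneg ha (hp.1 s)
    have := mul_nonneg hb (hq.1 s)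
    simp only [Finsupp.coe_add, Finsupp.coe_smul, Pi.add_apply, Pi.smul_apply, smul_eq_mul]
    linarith
  · rw [← wmean_one, wmean_eq_linearCombination, map_add, map_smul, map_smul,
      ← wmean_eq_linearCombination, ← wmean_eq_linearCombination, wmean_const hp, wmean_const hq]
    simpa using hab

lemma single_mem_finProb (s : S) : Finsupp.single s (1 : ℝ) ∈ finProb S := by
  refine ⟨fun x => ?_, ?_⟩
  · rw [Finsupp.single_apply]; split_ifs <;> norm_num
  · rw [Finsupp.support_single _ one_ne_zero]; simp

lemma support_nonempty {p : S →₀ ℝ} (hp : p ∈ finProb S) : p.support.Nonempty := by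
  rw [Finset.nonempty_iff_ne_empty]
  intro h0
  have := hp.2
  rw [h0, Finset.sum_empty] at this
  exact zero_ne_one this

/-- The finite-dimensional minimax theorem: against finitely many pure strategies of player 2,
player 1 has a finitely supported mixed strategy guaranteeing nearly the upper value. -/
lemma exists_finProb_forall_lt [Nonempty S] (f : S → T → ℝ) {c' c : ℝ} (hc : c' < c)
    (h : ∀ q ∈ finProb T, ∃ s, c < wmean q (f s)) (T₀ : Finset T) :
    ∃ p ∈ finProb S, ∀ t ∈ T₀, c' < wmean p (fun s => f s t) := by
  set C : Set (T₀ → ℝ) := (fun p t => wmean p (fun s => f s t)) '' finProb S with hC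
  set D : Set (T₀ → ℝ) := {y | ∀ t, c' < y t} with hD
  by_cases hCD : Disjoint D C
  swap
  · obtain ⟨y, hyD, p, hp, rfl⟩ := Set.not_disjoint_iff.1 hCD
    exact ⟨p, hp, fun t ht => hyD ⟨t, ht⟩⟩
  exfalso
  have hCconv : Convex ℝ C := by
    rintro _ ⟨p, hp, rfl⟩ _ ⟨p', hp', rfl⟩ a b ha hb hab
    refine ⟨a • p + b • p', convex_finProb hp hp' ha hb hab, ?_⟩
    funext t
    simp [wmean_eq_linearCombination]
  have hDpi : D = Set.univ.pi fun _ => Set.Ioi c' := by ext; simp [hD]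
  have hDopen : IsOpen D := by
    rw [hDpi]; exact isOpen_set_pi Set.finite_univ fun _ _ => isOpen_Ioi
  have hDconv : Convex ℝ D := by
    rw [hDpi]; exact convex_pi fun _ _ => convex_Ioi c'
  obtain ⟨F, u, hFD, hFC⟩ := geometric_hahn_banach_open hDconv hDopen hCconv hCD
  set e : T₀ → T₀ → ℝ := fun t => Pi.single t 1 with he
  have hF : ∀ y, F y = ∑ t, y t * F (e t) := by
    intro y
    conv_lhs => rw [← Finset.univ_sum_single y]
    rw [map_sum]
    refine Finset.sum_congr rfl fun t _ => ?_
    rw [← smul_eq_mul, ← map_smul]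
    congr 1
    rw [he, ← Pi.single_smul, smul_eq_mul, mul_one]
  have hneg : ∀ t, F (e t) ≤ 0 := by
    intro t
    by_contra! hpos
    set a₀ : T₀ → ℝ := fun _ => c' + 1
    obtain ⟨n, hn⟩ := exists_nat_gt ((u - F a₀) / F (e t))
    have h1 : a₀ + (n : ℝ) • e t ∈ D := by
      intro t'
      have : 0 ≤ e t t' := by
        simp only [he, Pi.single_apply]; split_ifs <;> norm_num
      have : 0 ≤ (n : ℝ) * e t t' := by positivity
      simp only [Pi.add_apply, Pi.smul_apply, smul_eq_mul, a₀]
      linarith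
    have h2 := hFD _ h1
    rw [map_add, map_smul, smul_eq_mul] at h2
    rw [div_lt_iff₀ hpos] at hn
    linarith
  obtain ⟨s₀⟩ := ‹Nonempty S›
  have hCs : ∀ s, u ≤ ∑ t : T₀, f s t * F (e t) := by
    intro s
    have := hFC _ ⟨_, single_mem_finProb s, rfl⟩
    rw [hF] at this
    simpa [wmean_eq_linearCombination] using this
  have hDc : ∀ δ > 0, (c' + δ) * ∑ t, F (e t) < u := by
    intro δ hδ
    have := hFD (fun _ => c' + δ) (fun t => by linarith)
    rw [hF] at this
    rwa [Finset.mul_sum]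
  set G := -∑ t, F (e t) with hG
  have hGpos : 0 < G := by
    have h0 : 0 ≤ G := by
      rw [hG, ← Finset.sum_neg_distrib]
      exact Finset.sum_nonneg fun t _ => by linarith [hneg t]
    refine lt_of_le_of_ne h0 fun h0 => ?_
    have hz : ∀ t, F (e t) = 0 := by
      have : ∑ t, -F (e t) = 0 := by rw [Finset.sum_neg_distrib, ← hG, ← h0]
      have := (Finset.sum_eq_zero_iff_of_nonneg fun t _ => by linarith [hneg t]).1 this
      intro t
      linarith [this t (Finset.mem_univ t)]
    have h1 := hCs s₀
    have h2 := hDc 1 one_pos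
    simp only [hz, mul_zero, Finset.sum_const_zero] at h1 h2
    linarith
  set q : T →₀ ℝ := ∑ t : T₀, Finsupp.single (t : T) (-F (e t) / G) with hq
  have hqmean : ∀ g : T → ℝ, wmean q g = (-∑ t : T₀, g t * F (e t)) / G := by
    intro g
    rw [wmean_eq_linearCombination, hq, map_sum, ← Finset.sum_neg_distrib, Finset.sum_div]
    refine Finset.sum_congr rfl fun t _ => ?_
    rw [Finsupp.linearCombination_single, smul_eq_mul]
    ring
  have hqP : q ∈ finProb T := by
    refine ⟨fun t => ?_, ?_⟩
    · rw [hq, Finsupp.finsetSum_apply]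
      refine Finset.sum_nonneg fun t' _ => ?_
      rw [Finsupp.single_apply]
      split_ifs
      · exact div_nonneg (by linarith [hneg t']) hGpos.le
      · exact le_rfl
    · rw [← wmean_one, hqmean]
      simp only [one_mul]
      exact div_self hGpos.ne'
  obtain ⟨s, hs⟩ := h q hqP
  rw [hqmean, lt_div_iff₀ hGpos] at hs
  have h1 := hCs s
  have h2 := hDc (c - c') (by linarith)
  have h3 : ∑ t, F (e t) = -G := by rw [hG, neg_neg]
  rw [h3] at h2
  linarith

/-- A Fatou-type argument on a compact space: if the `g j` are eventually at most `c₀` at every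
point, then no sequence of finitely supported weights can have means at least `c > c₀`. -/
lemma false_of_forall_eventually_le {X : Type*} [TopologicalSpace X] [CompactSpace X] [T2Space X]
    (g : ℕ → X → ℝ) (hg : ∀ j, Continuous (g j)) (hg0 : ∀ j x, 0 ≤ g j x) (hg1 : ∀ j x, g j x ≤ 1)
    {c₀ c : ℝ} (hc : c₀ < c) (hle : ∀ x, ∀ᶠ j in atTop, g j x ≤ c₀)
    (Φ : S → X) (p : ℕ → S →₀ ℝ) (hp : ∀ i, p i ∈ finProb S)
    (hpg : ∀ i j, j < i → c ≤ wmean (p i) (fun s => g j (Φ s))) : False := by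
  let _ : MeasurableSpace X := borel X
  have : BorelSpace X := ⟨rfl⟩
  let μ' : ℕ → Measure X := fun i =>
    ∑ s ∈ (p i).support, ENNReal.ofReal (p i s) • Measure.dirac (Φ s)
  have hμ' : ∀ i, IsProbabilityMeasure (μ' i) := by
    intro i
    refine ⟨?_⟩
    simp only [μ', Measure.coe_finsetSum, Finset.sum_apply, Measure.smul_apply, smul_eq_mul,
      measure_univ, mul_one]
    rw [← ENNReal.ofReal_sum_of_nonneg fun s _ => (hp i).1 s, (hp i).2, ENNReal.ofReal_one]
  let μ : ℕ → ProbabilityMeasure X := fun i => ⟨μ' i, hμ' i⟩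
  have hint : ∀ (ν : Measure X) [IsFiniteMeasure ν] (j : ℕ), Integrable (g j) ν := fun ν _ j =>
    Integrable.of_bound (hg j).aestronglyMeasurable 1 (ae_of_all _ fun x => by
      rw [Real.norm_eq_abs, abs_of_nonneg (hg0 j x)]; exact hg1 j x)
  have hμint : ∀ i j, ∫ x, g j x ∂(μ i : Measure X) = wmean (p i) (fun s => g j (Φ s)) := by
    intro i j
    change ∫ x, g j x ∂(μ' i) = _
    rw [integral_finsetSum_measure fun s _ => (hint _ j).smul_measure ENNReal.ofReal_ne_top]
    refine Finset.sum_congr rfl fun s _ => ?_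
    rw [integral_smul_measure, integral_dirac' _ _ (hg j).stronglyMeasurable,
      ENNReal.toReal_ofReal ((hp i).1 s), smul_eq_mul]
  obtain ⟨ν, hν⟩ : ∃ ν, Tendsto μ (hyperfilter ℕ) (𝓝 ν) :=
    ⟨_, Ultrafilter.le_nhds_lim ((hyperfilter ℕ).map μ)⟩
  have hνint : ∀ j, c ≤ ∫ x, g j x ∂(ν : Measure X) := by
    intro j
    have h1 := (ProbabilityMeasure.tendsto_iff_forall_integral_tendsto.1 hν)
      (BoundedContinuousFunction.mkOfCompact ⟨g j, hg j⟩)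
    refine ge_of_tendsto h1 ?_
    have h2 : ∀ᶠ i in (hyperfilter ℕ : Filter ℕ), j < i :=
      Nat.hyperfilter_le_atTop (eventually_gt_atTop j)
    filter_upwards [h2] with i hi
    exact (hpg i j hi).trans_eq (hμint i j).symm
  have hlim : Tendsto (fun j => ∫ x, max (g j x) c₀ ∂(ν : Measure X)) atTop
      (𝓝 (∫ _, c₀ ∂(ν : Measure X))) := by
    refine tendsto_integral_of_dominated_convergence (fun _ => max 1 |c₀|)
      (fun j => ((hg j).max continuous_const).aestronglyMeasurable) (integrable_const _)
      (fun j => ae_of_all _ fun x => ?_) (ae_of_all _ fun x => ?_)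
    · rw [Real.norm_eq_abs]
      refine abs_le.2 ⟨?_, ?_⟩
      · have := neg_abs_le c₀
        have := le_max_right (1 : ℝ) |c₀|
        have := le_max_right (g j x) c₀
        linarith
      · exact max_le_max (hg1 j x) (le_abs_self _)
    · refine tendsto_const_nhds.congr' ?_
      filter_upwards [hle x] with j hj
      exact (max_eq_right hj).symm
  rw [integral_const, probReal_univ, one_smul] at hlim
  refine absurd (ge_of_tendsto' hlim fun j => ?_) (not_le.2 hc)
  refine (hνint j).trans (integral_mono (hint _ j) ?_ fun x => le_max_left _ _)
  exact (hint _ j).sup (integrable_const _)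

end Weights

section Ladder

variable {S T : Type*}

/-- The relation `R` contains a half-graph (ladder) of length `k`. -/
def HasLadder (R : S → T → Prop) (k : ℕ) : Prop :=
  ∃ (s : Fin k → S) (t : Fin k → T), ∀ i j, R (s i) (t j) ↔ j ≤ i

/-- If `R` has no ladder of length `k` and `x` is finitely approximated by elements of `D`, then
there is a sequence in `D` such that each `t` with `x t` is missed by at most `k` terms. -/
lemma exists_seq_card_le {R : S → T → Prop} {k : ℕ} (hk : ¬HasLadder R k) [Nonempty T]
    (x : T → Prop) (D : Set S)
    (hx : ∀ T₀ : Finset T, (∀ t ∈ T₀, x t) → ∃ s ∈ D, ∀ t ∈ T₀, R s t) :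
    ∃ s : ℕ → S, (∀ n, s n ∈ D) ∧
      ∀ t, x t → ∀ I : Finset ℕ, (∀ i ∈ I, ¬R (s i) t) → I.card ≤ k := by
  have hw : ∀ A : Finset S, ∃ t, (∃ t', x t' ∧ ∀ a ∈ A, ¬R a t') → x t ∧ ∀ a ∈ A, ¬R a t := by
    intro A
    by_cases h : ∃ t', x t' ∧ ∀ a ∈ A, ¬R a t'
    · obtain ⟨t', ht'⟩ := h
      exact ⟨t', fun _ => ht'⟩
    · exact ⟨Classical.arbitrary T, fun h' => absurd h' h⟩
  choose w hw using hw
  have hG : ∀ F : Finset S, ∃ s ∈ D, ∀ A ⊆ F, x (w A) → R s (w A) := by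
    intro F
    obtain ⟨s, hsD, hs⟩ := hx ((F.powerset.image w).filter x) (by simp)
    refine ⟨s, hsD, fun A hA hxA => hs _ ?_⟩
    rw [Finset.mem_filter, Finset.mem_image]
    exact ⟨⟨A, Finset.mem_powerset.2 hA, rfl⟩, hxA⟩
  choose G hGD hGR using hG
  let F : ℕ → Finset S := fun n => Nat.rec ∅ (fun _ F => insert (G F) F) n
  have hFsucc : ∀ n, F (n + 1) = insert (G (F n)) (F n) := fun _ => rfl
  have hFmono : Monotone F := monotone_nat_of_le_succ fun n => by
    rw [hFsucc]; exact Finset.subset_insert _ _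
  have hmem : ∀ i j, i < j → G (F i) ∈ F j := fun i j hij =>
    hFmono (Nat.succ_le_of_lt hij) (by rw [hFsucc]; exact Finset.mem_insert_self _ _)
  refine ⟨fun n => G (F n), fun n => hGD _, fun t hxt I hI => ?_⟩
  by_contra! hcard
  obtain ⟨I', hI'I, hI'⟩ := Finset.exists_subset_card_eq (Nat.succ_le_of_lt hcard)
  let e := I'.orderEmbOfFin hI'
  have heR : ∀ i, ¬R (G (F (e i))) t := fun i =>
    hI _ (hI'I (I'.orderEmbOfFin_mem hI' i))
  let A : Fin k → Finset S := fun r =>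
    (Finset.univ.filter fun i => i ≤ r.castSucc).image fun i => G (F (e i))
  have hA : ∀ r, x (w (A r)) ∧ ∀ a ∈ A r, ¬R a (w (A r)) := fun r => by
    refine hw (A r) ⟨t, hxt, fun a ha => ?_⟩
    obtain ⟨i, -, rfl⟩ := Finset.mem_image.1 ha
    exact heR i
  refine hk ⟨fun l => G (F (e l.succ)), fun r => w (A r), fun l r => ⟨fun h => ?_, fun h => ?_⟩⟩
  · by_contra! hlt
    refine (hA r).2 _ (Finset.mem_image.2 ⟨l.succ, ?_, rfl⟩) h
    rw [Finset.mem_filter]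
    exact ⟨Finset.mem_univ _, Fin.succ_le_castSucc_iff.2 hlt⟩
  · refine hGR _ _ (fun a ha => ?_) (hA r).1
    obtain ⟨i, hi, rfl⟩ := Finset.mem_image.1 ha
    rw [Finset.mem_filter] at hi
    refine hmem _ _ (e.strictMono ?_)
    exact hi.2.trans_lt (Fin.castSucc_lt_succ_iff.2 h)

/-- The `0`-`1` payoff of a win-lose game as a real number. -/
noncomputable def payoff (R : S → T → Prop) (s : S) (t : T) : ℝ := if R s t then 1 else 0

lemma payoff_nonneg (R : S → T → Prop) (s : S) (t : T) : 0 ≤ payoff R s t := by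
  unfold payoff; split_ifs <;> norm_num

/-- Limit points of rows of `R` inherit, up to an arbitrarily small error, eventual upper bounds
on their means. -/
lemma eventually_wmean_le {R : S → T → Prop} {k : ℕ} (hk : ¬HasLadder R k) [Nonempty T]
    (x : T → Prop) (D : Set S)
    (hx : ∀ T₀ : Finset T, (∀ t ∈ T₀, x t) → ∃ s ∈ D, ∀ t ∈ T₀, R s t)
    (q : ℕ → T →₀ ℝ) (hq : ∀ j, q j ∈ finProb T) {c : ℝ}
    (hD : ∀ s ∈ D, ∀ᶠ j in atTop, wmean (q j) (payoff R s) ≤ c) {δ : ℝ} (hδ : 0 < δ) :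
    ∀ᶠ j in atTop, wmean (q j) (fun t => if x t then 1 else 0) ≤ c + δ := by
  obtain ⟨s, hsD, hs⟩ := exists_seq_card_le hk x D hx
  obtain ⟨N, hN⟩ := exists_nat_gt ((k : ℝ) / δ)
  have hN0 : (0 : ℝ) < N := lt_of_le_of_lt (by positivity) hN
  rw [div_lt_iff₀ hδ] at hN
  have hpt : ∀ t, (N : ℝ) * (if x t then 1 else 0) ≤
      (∑ i ∈ Finset.range N, payoff R (s i) t) + k := by
    intro t
    by_cases hxt : x t
    · have h1 := hs t hxt ((Finset.range N).filter fun i => ¬R (s i) t)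
        fun i hi => (Finset.mem_filter.1 hi).2
      have h2 := Finset.card_filter_add_card_filter_not (s := Finset.range N) fun i => R (s i) t
      have h3 : ∑ i ∈ Finset.range N, payoff R (s i) t =
          ((Finset.range N).filter fun i => R (s i) t).card := by
        simp [payoff]
      rw [h3, if_pos hxt, mul_one]
      rw [Finset.card_range] at h2
      exact_mod_cast (by omega : N ≤ ((Finset.range N).filter fun i => R (s i) t).card + k)
    · rw [if_neg hxt, mul_zero]
      have := Finset.sum_nonneg fun i (_ : i ∈ Finset.range N) => payoff_nonneg R (s i) t
      positivity
  have hev : ∀ᶠ j in atTop, ∀ i ∈ Finset.range N, wmean (q j) (payoff R (s i)) ≤ c :=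
    (Filter.eventually_all_finset _).2 fun i _ => hD _ (hsD i)
  filter_upwards [hev] with j hj
  have h1 := wmean_mono (hq j) fun t _ => hpt t
  rw [wmean_const_mul, wmean_add, wmean_const (hq j), wmean_finset_sum] at h1
  have h2 := Finset.sum_le_card_nsmul _ _ _ hj
  rw [Finset.card_range, nsmul_eq_mul] at h2
  refine le_of_mul_le_mul_left ?_ hN0
  linarith

/-- A relation without long ladders cannot have a gap between its lower and upper values on
finite sets. -/
lemma false_of_gap {R : S → T → Prop} {k : ℕ} (hk : ¬HasLadder R k) {c' c : ℝ} (hc : c' < c)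
    (hp : ∀ T₀ : Finset T, ∃ p ∈ finProb S, ∀ t ∈ T₀, c ≤ wmean p (fun s => payoff R s t))
    (hq : ∀ S₀ : Finset S, ∃ q ∈ finProb T, ∀ s ∈ S₀, wmean q (payoff R s) ≤ c') : False := by
  choose P hP hPc using hp
  choose Q hQ hQc using hq
  let st : ℕ → Finset S × Finset T := fun n =>
    Nat.rec (∅, ∅) (fun _ A => (A.1 ∪ (P A.2).support, A.2 ∪ (Q A.1).support)) n
  have hst : ∀ n, st (n + 1) = ((st n).1 ∪ (P (st n).2).support,
    (st n).2 ∪ (Q (st n).1).support) := fun _ => rfl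
  have hmono : Monotone st := monotone_nat_of_le_succ fun n => by
    rw [hst]; exact ⟨Finset.subset_union_left, Finset.subset_union_left⟩
  let D : Set S := {s | ∃ n, s ∈ (st n).1}
  have hPD : ∀ i, ∀ s ∈ (P (st i).2).support, s ∈ D := fun i s hs =>
    ⟨i + 1, by rw [hst]; exact Finset.mem_union_right _ hs⟩
  have hQG : ∀ i j, j < i → ∀ t ∈ (Q (st j).1).support, t ∈ (st i).2 := fun i j hji t ht =>
    (hmono (Nat.succ_le_of_lt hji)).2 (by rw [hst]; exact Finset.mem_union_right _ ht)
  have : Nonempty T := (support_nonempty (hQ ∅)).to_type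
  let row : S → T → Bool := fun s t => decide (R s t)
  let K : Set (T → Bool) := closure (row '' D)
  have : CompactSpace K := isCompact_iff_compactSpace.1 isClosed_closure.isCompact
  obtain ⟨s₀, hs₀⟩ := support_nonempty (hP (st 0).2)
  have hrow : ∀ s ∈ D, row s ∈ K := fun s hs => subset_closure ⟨s, hs, rfl⟩
  let Φ : S → K := fun s =>
    if h : s ∈ D then ⟨row s, hrow s h⟩ else ⟨row s₀, hrow s₀ (hPD 0 s₀ hs₀)⟩
  let g : ℕ → K → ℝ := fun j x => wmean (Q (st j).1) fun t => if x.1 t = true then 1 else 0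
  have hgΦ : ∀ j, ∀ s ∈ D, g j (Φ s) = wmean (Q (st j).1) (payoff R s) := by
    intro j s hs
    simp only [g, Φ, dif_pos hs, row, decide_eq_true_eq]
    rfl
  refine false_of_forall_eventually_le g (fun j => ?_) (fun j x => ?_) (fun j x => ?_)
    (c₀ := c' + (c - c') / 2) (c := c) (by linarith) (fun x => ?_) Φ
    (fun i => P (st i).2) (fun i => hP _) (fun i j hji => ?_)
  · refine continuous_finsetSum _ fun t _ => continuous_const.mul ?_
    exact (continuous_of_discreteTopology (f := fun b : Bool => if b = true then (1 : ℝ) else 0)).comp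
      ((continuous_apply t).comp continuous_subtype_val)
  · rw [← wmean_const (hQ (st j).1) 0]
    refine wmean_mono (hQ _) fun t _ => ?_
    split_ifs <;> norm_num
  · rw [← wmean_const (hQ (st j).1) 1]
    refine wmean_mono (hQ _) fun t _ => ?_
    split_ifs <;> norm_num
  · have hev := eventually_wmean_le hk (fun t => x.1 t = true) D (fun T₀ hT₀ => ?_)
      (fun j => Q (st j).1) (fun j => hQ _) (c := c') (fun s hs => ?_)
      (δ := (c - c') / 2) (by linarith)
    · filter_upwards [hev] with j hj
      convert hj
    · have hU : {y : T → Bool | ∀ t ∈ T₀, y t = x.1 t} ∈ 𝓝 x.1 := by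
        refine IsOpen.mem_nhds ?_ fun t _ => rfl
        exact isOpen_set_pi (s := fun t => {x.1 t}) T₀.finite_toSet fun t _ => isOpen_discrete _
      obtain ⟨_, hy, s, hs, rfl⟩ := mem_closure_iff_nhds.1 x.2 _ hU
      exact ⟨s, hs, fun t ht => of_decide_eq_true ((hy t ht).trans (hT₀ t ht))⟩
    · obtain ⟨n, hn⟩ := hs
      filter_upwards [eventually_ge_atTop n] with j hj
      exact hQc _ s ((hmono hj).1 hn)
  · rw [← wmean_const (hQ (st j).1) c]
    refine (wmean_mono (hQ _) fun t ht => hPc (st i).2 t (hQG i j hji t ht)).trans ?_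
    rw [← wmean_comm]
    exact wmean_mono (hP _) fun s hs => (hgΦ j s (hPD i s hs)).ge

end Ladder

section Minimax

variable {S T : Type*}

lemma mixedPayoff_eq_tsum_left (R : S → T → Prop) (p : PMF S) (q : PMF T) :
    mixedPayoff R p q = ∑' s, p s * ∑' t, q t * (if R s t then 1 else 0) := by
  unfold mixedPayoff
  refine tsum_congr fun s => ?_
  rw [← ENNReal.tsum_mul_left]
  exact tsum_congr fun t => mul_assoc _ _ _

lemma mixedPayoff_eq_tsum_right (R : S → T → Prop) (p : PMF S) (q : PMF T) :
    mixedPayoff R p q = ∑' t, q t * ∑' s, p s * (if R s t then 1 else 0) := by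
  unfold mixedPayoff
  rw [ENNReal.tsum_comm]
  refine tsum_congr fun t => ?_
  rw [← ENNReal.tsum_mul_left]
  refine tsum_congr fun s => ?_
  rw [mul_comm (p s), mul_assoc]

lemma PMF.tsum_mul_le (p : PMF S) {g : S → ℝ≥0∞} {c : ℝ≥0∞} (h : ∀ s, g s ≤ c) :
    ∑' s, p s * g s ≤ c :=
  calc ∑' s, p s * g s ≤ ∑' s, p s * c := ENNReal.tsum_le_tsum fun s => by gcongr; exact h s
    _ = c := by rw [ENNReal.tsum_mul_right, p.tsum_coe, one_mul]

lemma PMF.le_tsum_mul (p : PMF S) {g : S → ℝ≥0∞} {c : ℝ≥0∞} (h : ∀ s, c ≤ g s) :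
    c ≤ ∑' s, p s * g s :=
  calc c = ∑' s, p s * c := by rw [ENNReal.tsum_mul_right, p.tsum_coe, one_mul]
    _ ≤ ∑' s, p s * g s := ENNReal.tsum_le_tsum fun s => by gcongr; exact h s

/-- Finitely supported weights as a probability mass function. -/
noncomputable def finProbToPMF (p : S →₀ ℝ) (hp : p ∈ finProb S) : PMF S :=
  PMF.ofFinset (fun s => ENNReal.ofReal (p s)) p.support
    (by rw [← ENNReal.ofReal_sum_of_nonneg fun s _ => hp.1 s, hp.2, ENNReal.ofReal_one])
    (fun s hs => by rw [Finsupp.notMem_support_iff.1 hs, ENNReal.ofReal_zero])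

lemma tsum_finProbToPMF (p : S →₀ ℝ) (hp : p ∈ finProb S) (A : S → Prop) :
    ∑' s, finProbToPMF p hp s * (if A s then 1 else 0) =
      ENNReal.ofReal (wmean p fun s => if A s then 1 else 0) := by
  have hA : ∀ s, (0 : ℝ) ≤ if A s then 1 else 0 := fun s => by split_ifs <;> norm_num
  rw [wmean, ENNReal.ofReal_sum_of_nonneg fun s _ => mul_nonneg (hp.1 s) (hA s),
    tsum_eq_sum (s := p.support)]
  · refine Finset.sum_congr rfl fun s _ => ?_
    rw [ENNReal.ofReal_mul (hp.1 s)]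
    simp only [finProbToPMF, PMF.ofFinset_apply]
    split_ifs <;> simp
  · intro s hs
    simp only [finProbToPMF, PMF.ofFinset_apply]
    rw [Finsupp.notMem_support_iff.1 hs, ENNReal.ofReal_zero, zero_mul]

/-- A game whose winning relation has no ladder of some length satisfies the minimax property. -/
lemma minimax_of_not_hasLadder [Nonempty S] [Nonempty T] {R : S → T → Prop} {k : ℕ}
    (hk : ¬HasLadder R k) : Minimax R := by
  refine le_antisymm (iSup_iInf_le_iInf_iSup _) ?_
  by_contra! hlt
  obtain ⟨a, ha, hlt⟩ := ENNReal.lt_iff_exists_nnreal_btwn.1 hlt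
  obtain ⟨b, hab, hb⟩ := ENNReal.lt_iff_exists_nnreal_btwn.1 hlt
  have hab : (a : ℝ) < b := by exact_mod_cast hab
  have hupper : ∀ q ∈ finProb T, ∃ s, (b : ℝ) < wmean q (payoff R s) := by
    intro q hq
    by_contra! hle
    obtain ⟨p, hp⟩ := lt_iSup_iff.1 (hb.trans_le (iInf_le _ (finProbToPMF q hq)))
    refine hp.not_ge ?_
    rw [mixedPayoff_eq_tsum_left]
    refine PMF.tsum_mul_le p fun s => ?_
    rw [tsum_finProbToPMF]
    exact (ENNReal.ofReal_le_ofReal (hle s)).trans_eq (ENNReal.ofReal_coe_nnreal)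
  have hlower : ∀ p ∈ finProb S, ∃ t, wmean p (fun s => payoff R s t) < a := by
    intro p hp
    by_contra! hle
    obtain ⟨q, hq⟩ := iInf_lt_iff.1 ((le_iSup _ (finProbToPMF p hp)).trans_lt ha)
    refine hq.not_ge ?_
    rw [mixedPayoff_eq_tsum_right]
    refine PMF.le_tsum_mul q fun t => ?_
    rw [tsum_finProbToPMF]
    exact (ENNReal.ofReal_coe_nnreal).symm.trans_le (ENNReal.ofReal_le_ofReal (hle t))
  obtain ⟨a', haa', ha'b⟩ := exists_between hab
  obtain ⟨b', ha'b', hb'b⟩ := exists_between ha'b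
  refine false_of_gap hk ha'b' (fun T₀ => ?_) fun S₀ => ?_
  · obtain ⟨p, hp, hpt⟩ := exists_finProb_forall_lt (payoff R) hb'b hupper T₀
    exact ⟨p, hp, fun t ht => (hpt t ht).le⟩
  · have hneg : ∀ p ∈ finProb S, ∃ t, -(a : ℝ) < wmean p (fun s => -payoff R s t) := by
      intro p hp
      obtain ⟨t, ht⟩ := hlower p hp
      refine ⟨t, ?_⟩
      rw [wmean_neg]
      exact neg_lt_neg ht
    obtain ⟨q, hq, hqs⟩ := exists_finProb_forall_lt (fun t s => -payoff R s t)
      (neg_lt_neg haa') hneg S₀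
    refine ⟨q, hq, fun s hs => ?_⟩
    have := hqs s hs
    rw [wmean_neg] at this
    exact (neg_lt_neg_iff.1 this).le

lemma exists_lt_tsum_ite_le {q : ℕ → ℝ≥0∞} (hq : ∑' j, q j = 1) {ε : ℝ≥0∞} (hε : ε < 1) :
    ∃ n, ε < ∑' j, q j * (if j ≤ n then 1 else 0) := by
  have h := ENNReal.tendsto_nat_tsum q
  rw [hq] at h
  obtain ⟨n, hn⟩ := (h.eventually (lt_mem_nhds hε)).exists
  refine ⟨n, hn.trans_le ?_⟩
  refine le_trans (Finset.sum_le_sum fun j hj => ?_)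
    (ENNReal.sum_le_tsum (f := fun j => q j * (if j ≤ n then 1 else 0)) (Finset.range n))
  rw [if_pos (Finset.mem_range.1 hj).le, mul_one]

lemma exists_tsum_ite_le_le {p : ℕ → ℝ≥0∞} (hp : ∑' j, p j = 1) {ε : ℝ≥0∞} (hε : 0 < ε) :
    ∃ n, ∑' i, p i * (if n ≤ i then 1 else 0) ≤ ε := by
  have h := ENNReal.tendsto_sum_nat_add p (by rw [hp]; exact ENNReal.one_ne_top)
  obtain ⟨n, hn⟩ := (h.eventually (gt_mem_nhds hε)).exists
  refine ⟨n, le_trans (le_of_eq ?_) hn.le⟩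
  rw [← Summable.sum_add_tsum_nat_add' (k := n) ENNReal.summable, Finset.sum_eq_zero, zero_add]
  · simp
  · intro i hi
    rw [if_neg (not_le.2 (Finset.mem_range.1 hi)), mul_zero]

lemma mixedPayoff_pure_left (R : S → T → Prop) (s : S) (q : PMF T) :
    mixedPayoff R (PMF.pure s) q = ∑' t, q t * (if R s t then 1 else 0) := by
  rw [mixedPayoff_eq_tsum_left, tsum_eq_single s fun s' hs' => by simp [PMF.pure_apply, hs'] ]
  simp

lemma mixedPayoff_pure_right (R : S → T → Prop) (p : PMF S) (t : T) :
    mixedPayoff R p (PMF.pure t) = ∑' s, p s * (if R s t then 1 else 0) := by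
  rw [mixedPayoff_eq_tsum_right, tsum_eq_single t fun t' ht' => by simp [PMF.pure_apply, ht'] ]
  simp

/-- The game "name the larger number" does not satisfy the minimax property. -/
lemma not_minimax_of_equiv (e : ℕ ≃ S) (e' : ℕ ≃ T) {R : S → T → Prop}
    (h : ∀ i j, R (e i) (e' j) ↔ j ≤ i) : ¬Minimax R := by
  intro hm
  have hsup : 1 ≤ ⨅ q : PMF T, ⨆ p : PMF S, mixedPayoff R p q := by
    refine le_iInf fun q => le_of_forall_lt fun ε hε => ?_
    obtain ⟨n, hn⟩ := exists_lt_tsum_ite_le (q := fun j => q (e' j))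
      ((e'.tsum_eq q).trans q.tsum_coe) hε
    refine hn.trans_le (le_trans (le_of_eq ?_) (le_iSup _ (PMF.pure (e n))))
    rw [mixedPayoff_pure_left, ← e'.tsum_eq]
    simp only [h]
  have hinf : (⨆ p : PMF S, ⨅ q : PMF T, mixedPayoff R p q) ≤ 0 := by
    refine iSup_le fun p => le_of_forall_pos_le_add fun ε hε => ?_
    obtain ⟨n, hn⟩ := exists_tsum_ite_le_le (p := fun i => p (e i))
      ((e.tsum_eq p).trans p.tsum_coe) hε
    rw [zero_add]
    refine (iInf_le _ (PMF.pure (e' n))).trans (le_trans (le_of_eq ?_) hn)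
    rw [mixedPayoff_pure_right, ← e.tsum_eq]
    simp only [h]
  exact not_lt.2 (hsup.trans (hm.ge.trans hinf)) one_pos

end Minimax

section Stability

open FirstOrder.Language

/-- If arbitrarily long ladders for `φ` exist in a model, an ultrapower of it has an infinite
one. -/
lemma exists_infinite_ladder {L : FirstOrder.Language.{u, v}} {T : L.Theory} {n m : ℕ}
    (φ : L.Formula (Fin n ⊕ Fin m)) (M : FirstOrder.Language.Theory.ModelType.{u, v, w} T)
    (h : ∀ k, HasLadder (fun (a : Fin n → M) (b : Fin m → M) => φ.Realize (Sum.elim a b)) k) :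
    ∃ (N : FirstOrder.Language.Theory.ModelType.{u, v, w} T)
      (a : ℕ → (Fin n → N)) (b : ℕ → (Fin m → N)),
      ∀ i j, φ.Realize (Sum.elim (a i) (b j)) ↔ j ≤ i := by
  choose s t hst using h
  let U := hyperfilter ℕ
  let N := (U : Filter ℕ).Product fun _ => M
  have hN : N ⊨ T := (T.model_iff).2 fun σ hσ =>
    (Ultraproduct.sentence_realize σ).2 (Eventually.of_forall fun _ =>
      T.realize_sentence_of_mem hσ)
  let x : ℕ → ℕ → Fin n → M := fun i k =>
    if hi : i < k then s k ⟨i, hi⟩ else fun _ => Classical.arbitrary M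
  let y : ℕ → ℕ → Fin m → M := fun j k =>
    if hj : j < k then t k ⟨j, hj⟩ else fun _ => Classical.arbitrary M
  let z : ℕ → ℕ → Fin n ⊕ Fin m → ℕ → M := fun i j =>
    Sum.elim (fun l k => x i k l) fun l k => y j k l
  refine ⟨⟨N⟩, fun i l => ((fun k => x i k l : ℕ → M) : N),
    fun j l => ((fun k => y j k l : ℕ → M) : N), fun i j => ?_⟩
  have h1 : (Sum.elim (fun l => ((fun k => x i k l : ℕ → M) : N))
      (fun l => ((fun k => y j k l : ℕ → M) : N))) = fun l => ((z i j l : ℕ → M) : N) := by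
    funext l
    cases l <;> rfl
  have h2 : ∀ᶠ k in (U : Filter ℕ), (φ.Realize (fun l => z i j l k) ↔ j ≤ i) := by
    have h3 : ∀ᶠ k in (U : Filter ℕ), max i j < k :=
      Nat.hyperfilter_le_atTop (eventually_gt_atTop _)
    filter_upwards [h3] with k hk
    have hi : i < k := (le_max_left i j).trans_lt hk
    have hj : j < k := (le_max_right i j).trans_lt hk
    have h4 : (fun l => z i j l k) = Sum.elim (s k ⟨i, hi⟩) (t k ⟨j, hj⟩) := by
      funext l
      cases l
      · simp only [z, x, Sum.elim_inl, dif_pos hi]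
      · simp only [z, y, Sum.elim_inr, dif_pos hj]
    rw [h4]
    exact hst k ⟨i, hi⟩ ⟨j, hj⟩
  refine Iff.trans (iff_of_eq (congrArg φ.Realize h1)) ?_
  refine (Ultraproduct.realize_formula_cast φ (z i j)).trans ?_
  rw [eventually_congr h2, eventually_const]

/-- An infinite ladder for a game exhibits a subgame without the minimax property. -/
lemma not_totallyMinimax_of_ladder {S T : Type*} {R : S → T → Prop} (a : ℕ → S) (b : ℕ → T)
    (h : ∀ i j, R (a i) (b j) ↔ j ≤ i) : ¬TotallyMinimax R := by
  intro hR
  have ha : Function.Injective a := fun i j hij =>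
    le_antisymm ((h j i).1 (hij ▸ (h i i).2 le_rfl)) ((h i j).1 (hij ▸ (h j j).2 le_rfl))
  have hb : Function.Injective b := fun i j hij =>
    le_antisymm ((h j i).1 (hij ▸ (h j j).2 le_rfl)) ((h i j).1 (hij ▸ (h i i).2 le_rfl))
  exact not_minimax_of_equiv (Equiv.ofInjective a ha) (Equiv.ofInjective b hb) h
    (hR _ _ (Set.range_nonempty a) (Set.range_nonempty b))

end Stability

end Games

/-- Theorem 4.9: a complete first-order theory `T` is stable (no formula
`φ(x₁,…,xₙ; y₁,…,yₘ)` has the order property over `T`) if and only if for every such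
formula `φ` and every model `M` of `T`, the associated game — player 1 picks an
`n`-tuple `a` in `M`, player 2 picks an `m`-tuple `b` in `M`, and player 1 wins iff
`M ⊨ φ(a; b)` — is totally minimax. -/
theorem stable_iff_games_totallyMinimax
    (L : FirstOrder.Language.{u, v}) (T : L.Theory) (hT : T.IsComplete) :
    (¬ ∃ (n m : ℕ) (φ : L.Formula (Fin n ⊕ Fin m))
        (M : FirstOrder.Language.Theory.ModelType.{u, v, w} T)
        (a : ℕ → (Fin n → M)) (b : ℕ → (Fin m → M)),
        ∀ i j, φ.Realize (Sum.elim (a i) (b j)) ↔ j ≤ i) ↔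
    (∀ (n m : ℕ) (φ : L.Formula (Fin n ⊕ Fin m))
        (M : FirstOrder.Language.Theory.ModelType.{u, v, w} T),
        TotallyMinimax fun (a : Fin n → M) (b : Fin m → M) =>
          φ.Realize (Sum.elim a b)) := by
  constructor
  · intro hstable n m φ M S' T' hS' hT'
    have hk : ∃ k, ¬HasLadder (fun (a : Fin n → M) (b : Fin m → M) =>
        φ.Realize (Sum.elim a b)) k := by
      by_contra! hk
      exact hstable ⟨n, m, φ, exists_infinite_ladder φ M hk⟩
    obtain ⟨k, hk⟩ := hk
    have := hS'.to_subtype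
    have := hT'.to_subtype
    exact minimax_of_not_hasLadder (k := k) fun ⟨s, t, hst⟩ =>
      hk ⟨fun i => s i, fun j => t j, hst⟩
  · rintro hmm ⟨n, m, φ, M, a, b, h⟩
    exact not_totallyMinimax_of_ladder a b h (hmm n m φ M)
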